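/- (Theorem 2, main bound.) Let Θ be a measurable space, let f : Θ × ℝ^d → {−1, +1} be measurable, let D be a probability measure on ℝ^d × {−1, +1}, and define the expected misclassification risk R^{0-1}(θ) = E_{(x,y)∼D}[𝟙{f(θ, x) ≠ y}]. For a probability measure Q on Θ let F_Q(x) = E_{θ∼Q}[f(θ, x)], and for a sample S = ((x_1, y_1), …, (x_m, y_m)) define R_S^{lin}(F_Q) = (1/m) Σ_{i=1}^m ½(1 − y_i F_Q(x_i)). Let P be a probability measure on Θ, α > 1, and δ ∈ (0, 1]. Then with probability at least 1 − δ over S drawn from D^⊗m, for all probability measures Q on Θ and all λ > 1 simultaneously: E_{θ∼Q}[R^{0-1}(θ)] ≤ Φ_{λ/m}^{−1}[ R_S^{lin}(F_Q) + (α/λ)( KL(Q‖P) − log δ + 2 log( log(α²λ) / log α ) ) ], where Φ_γ^{−1}(t) = (1 − exp(−γt)) / (1 − exp(−γ)). -/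

import Mathlib

open MeasureTheory ProbabilityTheory Real
open scoped Classical

/-- The Kullback–Leibler divergence `KL(Q‖P)`, equal to `∫ log (dQ/dP) dQ` when `Q ≪ P`
(and the log-likelihood ratio is integrable), and `+∞` otherwise. -/
noncomputable def klDiv {α : Type*} [MeasurableSpace α] (Q P : Measure α) : ENNReal :=
  if Q ≪ P ∧ Integrable (llr Q P) Q then ENNReal.ofReal (∫ a, llr Q P a ∂Q) else ⊤

/-- `Φ_γ⁻¹(t) = (1 − exp(−γt)) / (1 − exp(−γ))`. -/
noncomputable def Phinv (γ t : ℝ) : ℝ := (1 - Real.exp (-γ * t)) / (1 - Real.exp (-γ))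

/-- The **Donsker–Varadhan inequality** for bounded functions. -/
lemma integral_le_toReal_klDiv_add_log_integral_exp {Θ : Type*} [MeasurableSpace Θ]
    (P Q : Measure Θ) [IsProbabilityMeasure P] [IsProbabilityMeasure Q] (h : klDiv Q P ≠ ⊤)
    {g : Θ → ℝ} (hg : Measurable g) {C : ℝ} (hC : ∀ θ, |g θ| ≤ C) :
    ∫ θ, g θ ∂Q ≤ (klDiv Q P).toReal + log (∫ θ, exp (g θ) ∂P) := by
  have hac : Q ≪ P ∧ Integrable (llr Q P) Q := by
    by_contra hc
    exact h (by simp [klDiv, hc])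
  have hgQ : Integrable g Q :=
    Integrable.of_bound hg.aestronglyMeasurable C (ae_of_all _ fun θ => by simpa using hC θ)
  have hgP : Integrable (fun θ => exp (g θ)) P :=
    Integrable.of_bound hg.exp.aestronglyMeasurable (exp C) (ae_of_all _ fun θ => by
      rw [Real.norm_eq_abs, abs_of_pos (exp_pos _)]
      exact exp_le_exp.2 ((le_abs_self _).trans (hC θ)))
  have : IsProbabilityMeasure (P.tilted g) := isProbabilityMeasure_tilted hgP
  have hacT : Q ≪ P.tilted g := hac.1.trans (absolutelyContinuous_tilted hgP)
  have hgibbs := InformationTheory.integral_llr_add_sub_measure_univ_nonneg hacT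
    (integrable_llr_tilted_right hac.1 hgQ hac.2 hgP)
  rw [integral_llr_tilted_right hac.1 hgQ hgP hac.2] at hgibbs
  simp only [probReal_univ] at hgibbs
  have hkl : ∫ θ, llr Q P θ ∂Q ≤ (klDiv Q P).toReal := by
    rw [klDiv, if_pos hac, ENNReal.toReal_ofReal']
    exact le_max_left _ _
  linarith

lemma exp_neg_le_one_sub_mul (γ : ℝ) {t : ℝ} (ht : t ∈ Set.Icc (0 : ℝ) 1) :
    exp (-(γ * t)) ≤ 1 - t * (1 - exp (-γ)) := by
  have := convexOn_exp.2 (Set.mem_univ 0) (Set.mem_univ (-γ)) (sub_nonneg.2 ht.2) ht.1 (by ring)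
  simp only [smul_eq_mul, mul_zero, zero_add, exp_zero, mul_one] at this
  calc exp (-(γ * t)) = exp (t * -γ) := by ring_nf
    _ ≤ _ := this
    _ = _ := by ring

lemma exp_neg_le_one_sub_mul_one_sub_exp {γ p : ℝ} (hγ : 0 < γ) (hp : p ∈ Set.Icc (0 : ℝ) 1) :
    exp (-γ) ≤ 1 - p * (1 - exp (-γ)) := by
  have : exp (-γ) < 1 := exp_lt_one_iff.2 (by linarith)
  nlinarith [hp.1, hp.2]

/-- The normalized log-Laplace transform of a Bernoulli variable is monotone. -/
lemma mul_log_one_sub_mul_le {a r p : ℝ} (ha : 0 < a) (hr : 1 ≤ r) (hp : p ∈ Set.Icc (0 : ℝ) 1) :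
    r * log (1 - p * (1 - exp (-a))) ≤ log (1 - p * (1 - exp (-(r * a)))) := by
  have hpos : 0 < 1 - p * (1 - exp (-a)) :=
    (exp_pos _).trans_le (exp_neg_le_one_sub_mul_one_sub_exp ha hp)
  rw [← log_rpow hpos]
  refine log_le_log (rpow_pos_of_pos hpos _) ?_
  have := (convexOn_rpow hr).2 (Set.mem_Ici.2 zero_le_one) (Set.mem_Ici.2 (exp_pos (-a)).le)
    (sub_nonneg.2 hp.2) hp.1 (by ring)
  simp only [smul_eq_mul, mul_one, one_rpow, ← exp_mul] at this
  calc (1 - p * (1 - exp (-a))) ^ r = (1 - p + p * exp (-a)) ^ r := by ring_nf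
    _ ≤ _ := this
    _ = _ := by ring_nf

/-- If `a ≤ b`, a bound on the log-Laplace transform at `a` yields a bound through `Φ_b⁻¹`. -/
lemma le_Phinv_of_neg_log_le {a b p t : ℝ} (ha : 0 < a) (hab : a ≤ b)
    (hp : p ∈ Set.Icc (0 : ℝ) 1) (h : -log (1 - p * (1 - exp (-a))) ≤ a * t) :
    p ≤ Phinv b t := by
  have hb : 0 < b := ha.trans_le hab
  have hmono := mul_log_one_sub_mul_le ha ((one_le_div ha).2 hab) hp
  rw [div_mul_cancel₀ _ ha.ne'] at hmono
  have hscale : b / a * -log (1 - p * (1 - exp (-a))) ≤ b / a * (a * t) := by gcongr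
  have hcancel : b / a * (a * t) = b * t := by field_simp
  have hpos : 0 < 1 - p * (1 - exp (-b)) :=
    (exp_pos _).trans_le (exp_neg_le_one_sub_mul_one_sub_exp hb hp)
  have hexp : exp (-b * t) ≤ 1 - p * (1 - exp (-b)) := by
    rw [← le_log_iff_exp_le hpos]
    linarith
  rw [Phinv, le_div_iff₀ (sub_pos.2 (exp_lt_one_iff.2 (by linarith)))]
  linarith

/-- A countable union bound with weights `1 / ((k + 1) (k + 2))`. -/
lemma one_sub_le_measure_forall_le {Ω : Type*} [MeasurableSpace Ω] (μ : Measure Ω)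
    [IsProbabilityMeasure μ] {M : ℕ → Ω → ENNReal} (hM : ∀ k, Measurable (M k))
    (hM1 : ∀ k, ∫⁻ ω, M k ω ∂μ ≤ 1) {δ : ℝ} (hδ : 0 < δ) :
    1 - ENNReal.ofReal δ ≤
      μ {ω | ∀ k : ℕ, M k ω ≤ ENNReal.ofReal (((k : ℝ) + 1) * (k + 2) / δ)} := by
  set c : ℕ → ℝ := fun k => ((k : ℝ) + 1) * (k + 2) / δ with hc
  have hcpos : ∀ k, 0 < c k := fun k => by positivity
  have hmeas : MeasurableSet {ω | ∀ k : ℕ, M k ω ≤ ENNReal.ofReal (c k)} := by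
    rw [Set.ofPred_forall]
    exact MeasurableSet.iInter fun k => measurableSet_le (hM k) measurable_const
  have hsum : ∀ n : ℕ, ∑ k ∈ Finset.range n, (c k)⁻¹ = δ * (1 - 1 / ((n : ℝ) + 1)) := by
    intro n
    induction n with
    | zero => simp
    | succ n ih =>
      rw [Finset.sum_range_succ, ih, hc]
      push_cast
      field_simp
      ring
  have hbad : μ {ω | ∀ k : ℕ, M k ω ≤ ENNReal.ofReal (c k)}ᶜ ≤ ENNReal.ofReal δ := by
    calc μ {ω | ∀ k : ℕ, M k ω ≤ ENNReal.ofReal (c k)}ᶜ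
        ≤ μ (⋃ k, {ω | ENNReal.ofReal (c k) ≤ M k ω}) := by
          refine measure_mono fun ω hω => ?_
          simp only [Set.mem_compl_iff, Set.mem_ofPred_eq, not_forall, not_le] at hω
          obtain ⟨k, hk⟩ := hω
          exact Set.mem_iUnion.2 ⟨k, hk.le⟩
      _ ≤ ∑' k, μ {ω | ENNReal.ofReal (c k) ≤ M k ω} := measure_iUnion_le _
      _ ≤ ∑' k, ENNReal.ofReal (c k)⁻¹ := by
          refine ENNReal.tsum_le_tsum fun k => ?_
          refine (meas_ge_le_lintegral_div (hM k).aemeasurable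
            (ENNReal.ofReal_pos.2 (hcpos k)).ne' ENNReal.ofReal_ne_top).trans ?_
          rw [ENNReal.ofReal_inv_of_pos (hcpos k), ← one_div]
          exact ENNReal.div_le_div_right (hM1 k) _
      _ ≤ ENNReal.ofReal δ := by
          refine ENNReal.tsum_le_of_sum_range_le fun n => ?_
          rw [← ENNReal.ofReal_sum_of_nonneg fun k _ => (inv_pos.2 (hcpos k)).le, hsum]
          refine ENNReal.ofReal_le_ofReal ?_
          have : 0 < 1 / ((n : ℝ) + 1) := by positivity
          nlinarith
  have hcompl := prob_compl_eq_one_sub (μ := μ) hmeas.compl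
  rw [compl_compl] at hcompl
  rw [hcompl]
  exact tsub_le_tsub_left hbad 1

section Risk

variable {Θ Z : Type*} [MeasurableSpace Θ] [MeasurableSpace Z]

/-- Expected risk of the parameter `θ` for the loss `ℓ`. -/
noncomputable def risk (ℓ : Θ → Z → ℝ) (D : Measure Z) (θ : Θ) : ℝ := ∫ z, ℓ θ z ∂D

/-- The exponent `mγ (Φ_γ(R(θ)) - R_S(θ))` of Catoni's exponential moment. -/
noncomputable def catoniExponent (ℓ : Θ → Z → ℝ) (D : Measure Z) {m : ℕ} (γ : ℝ)
    (S : Fin m → Z) (θ : Θ) : ℝ :=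
  -(m * log (1 - risk ℓ D θ * (1 - exp (-γ)))) - γ * ∑ i, ℓ θ (S i)

variable {ℓ : Θ → Z → ℝ} {m : ℕ} {γ : ℝ}

lemma measurable_risk (hℓ : Measurable (Function.uncurry ℓ)) (D : Measure Z) [SFinite D] :
    Measurable (risk ℓ D) :=
  hℓ.stronglyMeasurable.integral_prod_right.measurable

lemma integrable_loss (hℓ : Measurable (Function.uncurry ℓ))
    (hℓ01 : ∀ θ z, ℓ θ z ∈ Set.Icc (0 : ℝ) 1) (D : Measure Z) [IsFiniteMeasure D] (θ : Θ) :
    Integrable (ℓ θ) D :=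
  Integrable.of_mem_Icc 0 1 hℓ.of_uncurry_left.aemeasurable (ae_of_all _ (hℓ01 θ))

lemma risk_mem_Icc (hℓ : Measurable (Function.uncurry ℓ))
    (hℓ01 : ∀ θ z, ℓ θ z ∈ Set.Icc (0 : ℝ) 1) (D : Measure Z) [IsProbabilityMeasure D] (θ : Θ) :
    risk ℓ D θ ∈ Set.Icc (0 : ℝ) 1 :=
  (convex_Icc 0 1).integral_mem isClosed_Icc (ae_of_all _ (hℓ01 θ)) (integrable_loss hℓ hℓ01 D θ)

lemma measurable_catoniExponent (hℓ : Measurable (Function.uncurry ℓ)) (D : Measure Z)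
    [SFinite D] :
    Measurable fun q : (Fin m → Z) × Θ => catoniExponent ℓ D γ q.1 q.2 := by
  have h1 : Measurable fun q : (Fin m → Z) × Θ => risk ℓ D q.2 :=
    (measurable_risk hℓ D).comp measurable_snd
  have h2 (i : Fin m) : Measurable fun q : (Fin m → Z) × Θ => ℓ q.2 (q.1 i) :=
    hℓ.comp (measurable_snd.prodMk ((measurable_pi_apply i).comp measurable_fst))
  unfold catoniExponent
  exact (((h1.mul_const _).const_sub 1).log.const_mul _).neg.sub
    ((Finset.measurable_fun_sum _ fun i _ => h2 i).const_mul _)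

lemma abs_catoniExponent_le (hℓ : Measurable (Function.uncurry ℓ))
    (hℓ01 : ∀ θ z, ℓ θ z ∈ Set.Icc (0 : ℝ) 1) (D : Measure Z) [IsProbabilityMeasure D]
    (hγ : 0 < γ) (S : Fin m → Z) (θ : Θ) : |catoniExponent ℓ D γ S θ| ≤ m * γ := by
  have hR := risk_mem_Icc hℓ hℓ01 D θ
  have hlow := exp_neg_le_one_sub_mul_one_sub_exp hγ hR
  have hpos := (exp_pos _).trans_le hlow
  have hexp : exp (-γ) < 1 := exp_lt_one_iff.2 (by linarith)
  have hlog1 : -γ ≤ log (1 - risk ℓ D θ * (1 - exp (-γ))) := (le_log_iff_exp_le hpos).2 hlow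
  have hlog2 : log (1 - risk ℓ D θ * (1 - exp (-γ))) ≤ 0 :=
    log_nonpos hpos.le (by nlinarith [hR.1])
  have hsum0 : 0 ≤ ∑ i, ℓ θ (S i) := Finset.sum_nonneg fun i _ => (hℓ01 θ (S i)).1
  have hsum1 : ∑ i, ℓ θ (S i) ≤ m := by
    simpa using Finset.sum_le_sum fun i (_ : i ∈ Finset.univ) => (hℓ01 θ (S i)).2
  have hm : (0 : ℝ) ≤ m := m.cast_nonneg
  rw [catoniExponent, abs_le]
  constructor <;> nlinarith

/-- Catoni's exponential moment is at most one for every parameter. -/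
lemma lintegral_exp_catoniExponent_le_one (hℓ : Measurable (Function.uncurry ℓ))
    (hℓ01 : ∀ θ z, ℓ θ z ∈ Set.Icc (0 : ℝ) 1) (D : Measure Z) [IsProbabilityMeasure D]
    (hγ : 0 < γ) (θ : Θ) :
    ∫⁻ S, ENNReal.ofReal (exp (catoniExponent ℓ D γ S θ)) ∂Measure.pi (fun _ : Fin m => D) ≤ 1 := by
  set A := 1 - risk ℓ D θ * (1 - exp (-γ)) with hA
  have hApos : 0 < A := (exp_pos _).trans_le
    (exp_neg_le_one_sub_mul_one_sub_exp hγ (risk_mem_Icc hℓ hℓ01 D θ))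
  have hmeas : Measurable fun S : Fin m → Z => exp (catoniExponent ℓ D γ S θ) :=
    ((measurable_catoniExponent hℓ D).comp measurable_prodMk_right).exp
  have hint : Integrable (fun S : Fin m → Z => exp (catoniExponent ℓ D γ S θ))
      (Measure.pi fun _ : Fin m => D) :=
    Integrable.of_bound hmeas.aestronglyMeasurable (exp (m * γ)) (ae_of_all _ fun S => by
      rw [Real.norm_eq_abs, abs_of_pos (exp_pos _)]
      exact exp_le_exp.2 ((le_abs_self _).trans (abs_catoniExponent_le hℓ hℓ01 D hγ S θ)))
  rw [← ofReal_integral_eq_lintegral_ofReal hint (ae_of_all _ fun S => (exp_pos _).le),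
    ENNReal.ofReal_le_one]
  have hfac (S : Fin m → Z) : exp (catoniExponent ℓ D γ S θ) =
      (A ^ m)⁻¹ * ∏ i, exp (-(γ * ℓ θ (S i))) := by
    rw [catoniExponent, ← hA, sub_eq_add_neg, exp_add, exp_neg, ← log_pow, exp_log (by positivity),
      ← exp_sum, Finset.mul_sum, Finset.sum_neg_distrib]
  have hone : ∫ z, exp (-(γ * ℓ θ z)) ∂D ≤ A := by
    have hℓθ := integrable_loss hℓ hℓ01 D θ
    calc ∫ z, exp (-(γ * ℓ θ z)) ∂D ≤ ∫ z, (1 - ℓ θ z * (1 - exp (-γ))) ∂D := by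
          refine integral_mono_of_nonneg (ae_of_all _ fun z => (exp_pos _).le)
            ((integrable_const _).sub (hℓθ.mul_const _))
            (ae_of_all _ fun z => exp_neg_le_one_sub_mul γ (hℓ01 θ z))
      _ = A := by
          rw [integral_sub (integrable_const _) (hℓθ.mul_const _), integral_mul_const]
          simp [hA, risk]
  simp_rw [hfac]
  rw [integral_const_mul, integral_fintype_prod_eq_pow (fun z => exp (-(γ * ℓ θ z))),
    Fintype.card_fin, inv_mul_le_iff₀ (by positivity), mul_one]
  exact pow_le_pow_left₀ (integral_nonneg fun z => (exp_pos _).le) hone m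

lemma lintegral_lintegral_exp_catoniExponent_le_one (hℓ : Measurable (Function.uncurry ℓ))
    (hℓ01 : ∀ θ z, ℓ θ z ∈ Set.Icc (0 : ℝ) 1) (D : Measure Z) [IsProbabilityMeasure D]
    (P : Measure Θ) [IsProbabilityMeasure P] (hγ : 0 < γ) :
    ∫⁻ S, ∫⁻ θ, ENNReal.ofReal (exp (catoniExponent ℓ D γ S θ)) ∂P
      ∂Measure.pi (fun _ : Fin m => D) ≤ 1 := by
  rw [lintegral_lintegral_swap (measurable_catoniExponent hℓ D).exp.ennreal_ofReal.aemeasurable]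
  calc _ ≤ ∫⁻ _, 1 ∂P :=
        lintegral_mono fun θ => lintegral_exp_catoniExponent_le_one hℓ hℓ01 D hγ θ
    _ = 1 := by simp

/-- Change of measure and Jensen's inequality applied to Catoni's exponential moment. -/
lemma neg_mul_log_le_of_lintegral_exp_le (hℓ : Measurable (Function.uncurry ℓ))
    (hℓ01 : ∀ θ z, ℓ θ z ∈ Set.Icc (0 : ℝ) 1) (D : Measure Z) [IsProbabilityMeasure D]
    (P Q : Measure Θ) [IsProbabilityMeasure P] [IsProbabilityMeasure Q] (hKL : klDiv Q P ≠ ⊤)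
    (hγ : 0 < γ) (S : Fin m → Z) {c : ℝ} (hc : 0 < c)
    (hS : ∫⁻ θ, ENNReal.ofReal (exp (catoniExponent ℓ D γ S θ)) ∂P ≤ ENNReal.ofReal c) :
    -(m * log (1 - (∫ θ, risk ℓ D θ ∂Q) * (1 - exp (-γ)))) ≤
      γ * ∑ i, ∫ θ, ℓ θ (S i) ∂Q + (klDiv Q P).toReal + log c := by
  have hmeas : Measurable (catoniExponent ℓ D γ S) :=
    (measurable_catoniExponent hℓ D).comp measurable_prodMk_left
  have hint : Integrable (fun θ => exp (catoniExponent ℓ D γ S θ)) P :=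
    Integrable.of_bound hmeas.exp.aestronglyMeasurable (exp (m * γ)) (ae_of_all _ fun θ => by
      rw [Real.norm_eq_abs, abs_of_pos (exp_pos _)]
      exact exp_le_exp.2 ((le_abs_self _).trans (abs_catoniExponent_le hℓ hℓ01 D hγ S θ)))
  rw [← ofReal_integral_eq_lintegral_ofReal hint (ae_of_all _ fun S => (exp_pos _).le),
    ENNReal.ofReal_le_ofReal_iff hc.le] at hS
  have hDV := integral_le_toReal_klDiv_add_log_integral_exp P Q hKL hmeas
    (abs_catoniExponent_le hℓ hℓ01 D hγ S)
  have hlogc := log_le_log (integral_exp_pos hint) hS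
  have hRint : Integrable (risk ℓ D) Q := Integrable.of_mem_Icc 0 1
    (measurable_risk hℓ D).aemeasurable (ae_of_all _ (risk_mem_Icc hℓ hℓ01 D))
  have hXint : Integrable (fun θ => 1 - risk ℓ D θ * (1 - exp (-γ))) Q :=
    (integrable_const _).sub (hRint.mul_const _)
  have hX (θ : Θ) : 1 - risk ℓ D θ * (1 - exp (-γ)) ∈ Set.Icc (exp (-γ)) 1 := by
    have hR := risk_mem_Icc hℓ hℓ01 D θ
    have hexp : exp (-γ) < 1 := exp_lt_one_iff.2 (by linarith)
    exact ⟨exp_neg_le_one_sub_mul_one_sub_exp hγ hR, by nlinarith [hR.1]⟩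
  have hIcc : Set.Icc (exp (-γ)) 1 ⊆ Set.Ioi 0 := fun x hx => (exp_pos _).trans_le hx.1
  have hlogint : Integrable (fun θ => log (1 - risk ℓ D θ * (1 - exp (-γ)))) Q :=
    Integrable.of_mem_Icc (-γ) 0
      (((measurable_risk hℓ D).mul_const _).const_sub 1).log.aemeasurable
      (ae_of_all _ fun θ => ⟨(le_log_iff_exp_le (hIcc (hX θ))).2 (hX θ).1,
        log_nonpos (hIcc (hX θ)).le (hX θ).2⟩)
  have hjensen := (strictConcaveOn_log_Ioi.concaveOn.subset hIcc (convex_Icc _ _)).le_map_integral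
    (continuousOn_log.mono fun x hx => (hIcc hx).ne') isClosed_Icc (ae_of_all _ hX) hXint hlogint
  have hℓint (i : Fin m) : Integrable (fun θ => ℓ θ (S i)) Q :=
    Integrable.of_mem_Icc 0 1 hℓ.of_uncurry_right.aemeasurable
      (ae_of_all _ fun θ => hℓ01 θ (S i))
  have hXval : ∫ θ, (1 - risk ℓ D θ * (1 - exp (-γ))) ∂Q =
      1 - (∫ θ, risk ℓ D θ ∂Q) * (1 - exp (-γ)) := by
    rw [integral_sub (integrable_const _) (hRint.mul_const _), integral_mul_const]
    simp
  have hexpand : ∫ θ, catoniExponent ℓ D γ S θ ∂Q =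
      -(m * ∫ θ, log (1 - risk ℓ D θ * (1 - exp (-γ))) ∂Q) - γ * ∑ i, ∫ θ, ℓ θ (S i) ∂Q := by
    have hneg : Integrable (fun θ => -(m * log (1 - risk ℓ D θ * (1 - exp (-γ))))) Q :=
      (hlogint.const_mul _).neg
    simp only [catoniExponent]
    rw [integral_sub hneg ((integrable_finsetSum _ fun i _ => hℓint i).const_mul _), integral_neg,
      integral_const_mul, integral_const_mul, integral_finsetSum _ fun i _ => hℓint i]
  rw [hXval] at hjensen
  have := mul_le_mul_of_nonneg_left hjensen (m.cast_nonneg (α := ℝ))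
  linarith

/-- The geometric grid point below `l` loses at most a factor `α` and a doubly logarithmic term. -/
lemma exists_pow_le_and_log_le {α l : ℝ} (hα : 1 < α) (hl : 1 < l) :
    ∃ k : ℕ, α ^ k ≤ l ∧ l ≤ α * α ^ k ∧
      log (((k : ℝ) + 1) * (k + 2)) ≤ 2 * log (log (α ^ 2 * l) / log α) := by
  have hα0 : 0 < α := by linarith
  have hl0 : 0 < l := by linarith
  have hlogα : 0 < log α := log_pos hα
  have hfloor := Nat.floor_le (div_nonneg (log_pos hl).le hlogα.le)
  have hlt := Nat.lt_floor_add_one (log l / log α)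
  set k := ⌊log l / log α⌋₊
  refine ⟨k, ?_, ?_, ?_⟩
  · rw [← log_le_log_iff (by positivity) hl0, log_pow]
    exact (le_div_iff₀ hlogα).1 hfloor
  · rw [← pow_succ', ← log_le_log_iff hl0 (by positivity), log_pow, Nat.cast_succ]
    exact ((div_lt_iff₀ hlogα).1 hlt).le
  · have hratio : log (α ^ 2 * l) / log α = 2 + log l / log α := by
      rw [log_mul (by positivity) hl0.ne', log_pow, add_div, mul_div_cancel_right₀ _ hlogα.ne',
        Nat.cast_two]
    have hk : (0 : ℝ) ≤ k := k.cast_nonneg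
    calc log (((k : ℝ) + 1) * (k + 2)) ≤ log (((k : ℝ) + 2) ^ 2) :=
          log_le_log (by positivity) (by nlinarith)
      _ = 2 * log ((k : ℝ) + 2) := by rw [log_pow, Nat.cast_two]
      _ ≤ _ := by
          rw [hratio]
          have := log_le_log (by positivity) (by linarith : (k : ℝ) + 2 ≤ 2 + log l / log α)
          linarith

/-- **Catoni's PAC-Bayes bound** for `[0, 1]`-valued losses, uniform in the inverse
temperature `l > 1`. -/
theorem pacBayes_catoni_uniform (hℓ : Measurable (Function.uncurry ℓ))
    (hℓ01 : ∀ θ z, ℓ θ z ∈ Set.Icc (0 : ℝ) 1) (D : Measure Z) [IsProbabilityMeasure D]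
    (hm : 1 ≤ m) (P : Measure Θ) [IsProbabilityMeasure P] {α δ : ℝ} (hα : 1 < α)
    (hδ : δ ∈ Set.Ioc (0 : ℝ) 1) :
    1 - ENNReal.ofReal δ ≤ Measure.pi (fun _ : Fin m => D)
      {S | ∀ Q : Measure Θ, IsProbabilityMeasure Q → ∀ l : ℝ, 1 < l → klDiv Q P ≠ ⊤ →
        ∫ θ, risk ℓ D θ ∂Q ≤ Phinv (l / m) ((1 / (m : ℝ)) * ∑ i, ∫ θ, ℓ θ (S i) ∂Q +
          (α / l) * ((klDiv Q P).toReal - log δ + 2 * log (log (α ^ 2 * l) / log α)))} := by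
  have hm0 : (0 : ℝ) < m := by exact_mod_cast hm
  have hα0 : 0 < α := by linarith
  have hγ (k : ℕ) : 0 < α ^ k / m := by positivity
  refine (one_sub_le_measure_forall_le (Measure.pi fun _ : Fin m => D)
    (M := fun k S => ∫⁻ θ, ENNReal.ofReal (exp (catoniExponent ℓ D (α ^ k / m) S θ)) ∂P)
    (fun k => (measurable_catoniExponent hℓ D).exp.ennreal_ofReal.lintegral_prod_right')
    (fun k => lintegral_lintegral_exp_catoniExponent_le_one hℓ hℓ01 D P (hγ k)) hδ.1).trans
    (measure_mono fun S hS Q hQ l hl hKL => ?_)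
  obtain ⟨k, hkl, hlk, hlog⟩ := exists_pow_le_and_log_le hα hl
  have hl0 : 0 < l := by linarith
  have hc1 : 1 ≤ ((k : ℝ) + 1) * (k + 2) / δ := by
    rw [le_div_iff₀ hδ.1]
    nlinarith [hδ.2, k.cast_nonneg (α := ℝ)]
  have hbound := neg_mul_log_le_of_lintegral_exp_le hℓ hℓ01 D P Q hKL (hγ k) S
    (zero_lt_one.trans_le hc1) (hS k)
  have hrisk : ∫ θ, risk ℓ D θ ∂Q ∈ Set.Icc (0 : ℝ) 1 :=
    (convex_Icc 0 1).integral_mem isClosed_Icc (ae_of_all _ (risk_mem_Icc hℓ hℓ01 D))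
      (Integrable.of_mem_Icc 0 1 (measurable_risk hℓ D).aemeasurable
        (ae_of_all _ (risk_mem_Icc hℓ hℓ01 D)))
  refine le_Phinv_of_neg_log_le (hγ k) (by gcongr) hrisk ?_
  set B := (klDiv Q P).toReal - log δ + 2 * log (log (α ^ 2 * l) / log α)
  have hB : (klDiv Q P).toReal + log (((k : ℝ) + 1) * (k + 2) / δ) ≤ B := by
    rw [log_div (by positivity) hδ.1.ne']
    linarith
  have hB0 : 0 ≤ B := by
    have := log_nonneg hc1
    have := ENNReal.toReal_nonneg (a := klDiv Q P)
    linarith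
  have hscale : B ≤ α * α ^ k / l * B :=
    le_mul_of_one_le_left hB0 ((one_le_div hl0).2 hlk)
  refine le_of_mul_le_mul_left ?_ hm0
  calc m * -log (1 - (∫ θ, risk ℓ D θ ∂Q) * (1 - exp (-(α ^ k / m))))
      ≤ α ^ k / m * ∑ i, ∫ θ, ℓ θ (S i) ∂Q + α * α ^ k / l * B := by linarith
    _ = _ := by field_simp

end Risk

lemma ite_ne_eq_half_mul_one_sub {a y : ℝ} (ha : a ∈ ({-1, 1} : Set ℝ))
    (hy : y ∈ ({-1, 1} : Set ℝ)) : (if a ≠ y then (1 : ℝ) else 0) = 1 / 2 * (1 - y * a) := by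
  rcases ha with rfl | rfl <;> rcases hy with rfl | rfl <;> norm_num

/-- Theorem 2 (main bound): a directly differentiable PAC-Bayes bound on the
misclassification risk of signed-output networks, holding for all posteriors `Q` and all
`λ > 1` simultaneously.  When `KL(Q‖P) = ∞` the claimed bound is trivially true (its
right-hand side is `+∞`), which is expressed by the disjunction. -/
theorem statement18 {Θ : Type*} [MeasurableSpace Θ] (d : ℕ)
    (f : Θ → EuclideanSpace ℝ (Fin d) → ℝ) (hf : Measurable (Function.uncurry f))
    (hfval : ∀ θ x, f θ x ∈ ({-1, 1} : Set ℝ))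
    (D : Measure (EuclideanSpace ℝ (Fin d) × ℝ)) [IsProbabilityMeasure D]
    (hD : ∀ᵐ p ∂D, p.2 ∈ ({-1, 1} : Set ℝ))
    (m : ℕ) (hm : 1 ≤ m)
    (P : Measure Θ) [IsProbabilityMeasure P]
    (α δ : ℝ) (hα : 1 < α) (hδ : δ ∈ Set.Ioc (0 : ℝ) 1) :
    1 - ENNReal.ofReal δ ≤
      Measure.pi (fun _ : Fin m => D)
        {S | ∀ Q : Measure Θ, IsProbabilityMeasure Q → ∀ l : ℝ, 1 < l →
          klDiv Q P = ⊤ ∨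
          -- expected misclassification risk of the stochastic classifier …
          ∫ θ, (∫ p, (if f θ p.1 ≠ p.2 then (1 : ℝ) else 0) ∂D) ∂Q ≤
            -- … is bounded via the empirical linear loss of the aggregate `F_Q`
            Phinv (l / m)
              (((1 / (m : ℝ)) * ∑ i, 1 / 2 * (1 - (S i).2 * ∫ θ, f θ (S i).1 ∂Q)) +
                (α / l) * ((klDiv Q P).toReal - Real.log δ +
                  2 * Real.log (Real.log (α ^ 2 * l) / Real.log α)))} := by
  set ℓ : Θ → EuclideanSpace ℝ (Fin d) × ℝ → ℝ :=
    fun θ p => if f θ p.1 ≠ p.2 then (1 : ℝ) else 0 with hℓdef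
  have hf' : Measurable fun q : Θ × (EuclideanSpace ℝ (Fin d) × ℝ) => f q.1 q.2.1 :=
    hf.comp (measurable_fst.prodMk (measurable_fst.comp measurable_snd))
  have hℓ : Measurable (Function.uncurry ℓ) :=
    Measurable.ite (measurableSet_eq_fun hf' (measurable_snd.comp measurable_snd)).compl
      measurable_const measurable_const
  have hℓ01 (θ p) : ℓ θ p ∈ Set.Icc (0 : ℝ) 1 := by
    simp only [hℓdef]
    split_ifs <;> simp
  have hlabels : ∀ᵐ S ∂Measure.pi (fun _ : Fin m => D), ∀ i, (S i).2 ∈ ({-1, 1} : Set ℝ) :=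
    ae_all_iff.2 fun i =>
      (Measure.tendsto_eval_ae_ae (μ := fun _ : Fin m => D) (i := i)).eventually hD
  refine (pacBayes_catoni_uniform hℓ hℓ01 D hm P hα hδ).trans (measure_mono_ae ?_)
  filter_upwards [hlabels] with S hlab hS Q hQ l hl
  refine or_iff_not_imp_left.2 fun hKL => ?_
  have hfint (i : Fin m) : Integrable (fun θ => f θ (S i).1) Q :=
    Integrable.of_mem_Icc (-1) 1 hf.of_uncurry_right.aemeasurable (ae_of_all _ fun θ => by
      rcases hfval θ (S i).1 with h | h <;> rw [h] <;> norm_num)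
  have hlin (i : Fin m) :
      ∫ θ, ℓ θ (S i) ∂Q = 1 / 2 * (1 - (S i).2 * ∫ θ, f θ (S i).1 ∂Q) := by
    simp only [hℓdef, ite_ne_eq_half_mul_one_sub (hfval _ _) (hlab i)]
    rw [integral_const_mul, integral_sub (integrable_const _) ((hfint i).const_mul _),
      integral_const_mul]
    simp
  have h := hS Q hQ l hl hKL
  simp only [hlin] at h
  exact h
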